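/- Let x ∈ ℂ, r > 0, and let K ⊆ ℂ be a closed set such that K ∪ ∂B(x,r) is connected, where ∂B(x,r) is the circle {z : |z − x| = r}. Then every connected component of the open set B(x,r) ∖ K (where B(x,r) = {z : |z − x| < r}) is a simply connected open set. -/

import Mathlib

/-- Adjacency (or equality) in the triangular lattice with vertex set `ℤ × ℤ`. -/
def TriAdj (u v : ℤ × ℤ) : Prop :=
  |u.1 - v.1| ≤ 1 ∧ |u.2 - v.2| ≤ 1 ∧ |(u.1 - v.1) - (u.2 - v.2)| ≤ 1

namespace TriAdj

theorem refl (u : ℤ × ℤ) : TriAdj u u := by simp [TriAdj]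

theorem symm {u v : ℤ × ℤ} (h : TriAdj u v) : TriAdj v u := by
  simp only [TriAdj, abs_le] at h ⊢
  omega

/-- The signed number of times the step from `u` to `v` crosses the upward ray issuing from `p`,
pushed slightly to the right. -/
def crossing (p u v : ℤ × ℤ) : ℤ :=
  (if u.1 = p.1 ∧ p.2 < u.2 ∧ v.1 = p.1 + 1 then 1 else 0) -
    (if v.1 = p.1 ∧ p.2 < v.2 ∧ u.1 = p.1 + 1 then 1 else 0)

theorem exists_crossing_sub_crossing_eq_of_adj {p q : ℤ × ℤ} (h : TriAdj p q) :
    ∃ χ : ℤ × ℤ → ℤ, ∀ u v, TriAdj u v → u ≠ p → u ≠ q → v ≠ p → v ≠ q →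
      crossing p u v - crossing q u v = χ v - χ u := by
  wlog hpq : p.1 ≤ q.1 generalizing p q
  · obtain ⟨χ, hχ⟩ := this h.symm (by omega)
    refine ⟨-χ, fun u v huv hup huq hvp hvq => ?_⟩
    have := hχ u v huv huq hup hvq hvp
    simp only [Pi.neg_apply]
    omega
  obtain ⟨a, b⟩ := p
  obtain ⟨c, d⟩ := q
  simp only [TriAdj, abs_le] at h hpq
  obtain rfl | rfl : c = a ∨ c = a + 1 := by omega
  · refine ⟨0, ?_⟩
    rintro ⟨x, y⟩ ⟨x', y'⟩ huv hup huq hvp hvq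
    simp only [TriAdj, abs_le, ne_eq, Prod.mk.injEq, crossing, Pi.zero_apply] at *
    split_ifs <;> omega
  · refine ⟨fun u => if u.1 = a + 1 ∧ d < u.2 then 1 else 0, ?_⟩
    rintro ⟨x, y⟩ ⟨x', y'⟩ huv hup huq hvp hvq
    simp only [TriAdj, abs_le, ne_eq, Prod.mk.injEq, crossing] at *
    split_ifs <;> omega

theorem exists_crossing_sub_crossing_eq {G : Set (ℤ × ℤ)} {p q : ℤ × ℤ}
    (h : Relation.ReflTransGen (fun a b => TriAdj a b ∧ a ∉ G ∧ b ∉ G) p q) :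
    ∃ χ : ℤ × ℤ → ℤ, ∀ u ∈ G, ∀ v ∈ G, TriAdj u v →
      crossing p u v - crossing q u v = χ v - χ u := by
  induction h with
  | refl => exact ⟨0, by simp⟩
  | @tail b c _ hbc ih =>
    obtain ⟨χ, hχ⟩ := ih
    obtain ⟨hadj, hb, hc⟩ := hbc
    obtain ⟨ψ, hψ⟩ := exists_crossing_sub_crossing_eq_of_adj hadj
    refine ⟨χ + ψ, fun u hu v hv huv => ?_⟩
    have h₁ := hχ u hu v hv huv
    have h₂ := hψ u v huv (ne_of_mem_of_not_mem hu hb) (ne_of_mem_of_not_mem hu hc)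
      (ne_of_mem_of_not_mem hv hb) (ne_of_mem_of_not_mem hv hc)
    simp only [Pi.add_apply]
    omega

/-- If `s` is the rightmost vertex in the top row of `G`, and the complement of `G` is connected and
contains the lower left neighbour of `s`, then the left and lower neighbours of `s` are separated
in `G \ {s}`. -/
theorem exists_separating_function {G : Finset (ℤ × ℤ)}
    (hG : ∀ p ∉ G, ∀ q ∉ G,
      Relation.ReflTransGen (fun a b => TriAdj a b ∧ a ∉ G ∧ b ∉ G) p q)
    {s : ℤ × ℤ} (hs : s ∈ G) (hmax : ∀ u ∈ G, u.2 < s.2 ∨ (u.2 = s.2 ∧ u.1 ≤ s.1))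
    (hSW : (s.1 - 1, s.2 - 1) ∉ G) (hW : (s.1 - 1, s.2) ∈ G) :
    ∃ χ : ℤ × ℤ → ℤ, (∀ u ∈ G, ∀ v ∈ G, u ≠ s → v ≠ s → TriAdj u v → χ u = χ v) ∧
      ((s.1, s.2 - 1) ∈ G → χ (s.1, s.2 - 1) ≠ χ (s.1 - 1, s.2)) := by
  obtain ⟨a, b⟩ := s
  have hN : (a, b + 1) ∉ G := fun h => by have := hmax _ h; simp at this
  obtain ⟨χ, hχ⟩ := exists_crossing_sub_crossing_eq (G := G) (hG _ hSW _ hN)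
  refine ⟨χ, ?_, fun hS => ?_⟩
  · rintro ⟨x, y⟩ hu ⟨x', y'⟩ hv hus hvs huv
    have h := hχ _ hu _ hv huv
    have h₁ := hmax _ hu
    have h₂ := hmax _ hv
    simp only [TriAdj, abs_le, ne_eq, Prod.mk.injEq, crossing] at *
    split_ifs at h <;> omega
  · have h₁ := hχ _ hW _ hs (by simp [TriAdj])
    have h₂ := hχ _ hS _ hs (by simp [TriAdj])
    simp [crossing] at h₁ h₂
    simp only
    omega

/-- A finite set of vertices of the triangular lattice whose complement is connected has trivial
first cohomology, with coefficients in an arbitrary group. -/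
theorem exists_potential {H : Type*} [Group H] (G : Finset (ℤ × ℤ))
    (hG : ∀ p ∉ G, ∀ q ∉ G,
      Relation.ReflTransGen (fun a b => TriAdj a b ∧ a ∉ G ∧ b ∉ G) p q)
    (φ : ℤ × ℤ → ℤ × ℤ → H)
    (hφ : ∀ u ∈ G, ∀ v ∈ G, ∀ w ∈ G, TriAdj u v → TriAdj v w → TriAdj u w →
      φ u v * φ v w = φ u w) :
    ∃ f : ℤ × ℤ → H, ∀ u ∈ G, ∀ v ∈ G, TriAdj u v → f u * φ u v = f v := by
  induction hn : G.card generalizing G with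
  | zero => exact ⟨1, by simp_all⟩
  | succ n ih =>
    obtain ⟨s, hs, hmax⟩ : ∃ s ∈ G, ∀ u ∈ G, u.2 < s.2 ∨ (u.2 = s.2 ∧ u.1 ≤ s.1) := by
      obtain ⟨s, hs, h⟩ := G.exists_max_image (fun u => toLex (u.2, u.1))
        (Finset.card_pos.1 (by omega))
      exact ⟨s, hs, fun u hu => by simpa [Prod.Lex.toLex_le_toLex] using h u hu⟩
    have hN : (s.1, s.2 + 1) ∉ G := fun h => by have := hmax _ h; simp at this
    have hNs : TriAdj (s.1, s.2 + 1) s := by simp [TriAdj]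
    have mono : ∀ {p q}, Relation.ReflTransGen (fun a b => TriAdj a b ∧ a ∉ G ∧ b ∉ G) p q →
        Relation.ReflTransGen (fun a b => TriAdj a b ∧ a ∉ G.erase s ∧ b ∉ G.erase s) p q :=
      fun h => Relation.ReflTransGen.mono
        (fun a b hab => ⟨hab.1, by simp [hab.2.1], by simp [hab.2.2]⟩) _ _ h
    have hG' : ∀ p ∉ G.erase s, ∀ q ∉ G.erase s, Relation.ReflTransGen
        (fun a b => TriAdj a b ∧ a ∉ G.erase s ∧ b ∉ G.erase s) p q := by
      have toN : ∀ p ∉ G.erase s, Relation.ReflTransGen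
          (fun a b => TriAdj a b ∧ a ∉ G.erase s ∧ b ∉ G.erase s) p (s.1, s.2 + 1) := by
        intro p hp
        by_cases hps : p = s
        · exact .single ⟨hps ▸ hNs.symm, hp, by simp [hN]⟩
        · exact mono (hG _ (by simpa [hps] using hp) _ hN)
      have ofN : ∀ p ∉ G.erase s, Relation.ReflTransGen
          (fun a b => TriAdj a b ∧ a ∉ G.erase s ∧ b ∉ G.erase s) (s.1, s.2 + 1) p := by
        intro p hp
        by_cases hps : p = s
        · exact .single ⟨hps ▸ hNs, by simp [hN], hp⟩
        · exact mono (hG _ hN _ (by simpa [hps] using hp))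
      exact fun p hp q hq => (toN p hp).trans (ofN q hq)
    obtain ⟨f, hf⟩ := ih (G.erase s) hG'
      (fun u hu v hv w hw => hφ u (Finset.mem_of_mem_erase hu) v (Finset.mem_of_mem_erase hv)
        w (Finset.mem_of_mem_erase hw)) (by rw [Finset.card_erase_of_mem hs, hn]; rfl)
    have hφss : φ s s = 1 := by
      simpa using hφ s hs s hs s hs (refl s) (refl s) (refl s)
    have hnbr : ∀ u ∈ G, u ≠ s → TriAdj u s →
        u = (s.1 - 1, s.2) ∨ u = (s.1, s.2 - 1) ∨ u = (s.1 - 1, s.2 - 1) := by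
      rintro ⟨x, y⟩ hu hus hadj
      have := hmax _ hu
      obtain ⟨a, b⟩ := s
      simp only [TriAdj, abs_le, ne_eq, Prod.mk.injEq] at *
      omega
    suffices ∃ (f' : ℤ × ℤ → H) (y : H),
        (∀ u ∈ G, ∀ v ∈ G, u ≠ s → v ≠ s → TriAdj u v → f' u * φ u v = f' v) ∧
        ∀ u ∈ G, u ≠ s → TriAdj u s → f' u * φ u s = y by
      obtain ⟨f', y, hf', hy⟩ := this
      refine ⟨Function.update f' s y, fun u hu v hv huv => ?_⟩
      by_cases hus : u = s <;> by_cases hvs : v = s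
      · subst hus; subst hvs; simp [hφss]
      · subst hus
        rw [Function.update_self, Function.update_of_ne hvs, ← hy v hv hvs huv.symm, mul_assoc,
          hφ v hv u hu v hv huv.symm huv (refl v)]
        exact hf' v hv v hv hvs hvs (refl v)
      · subst hvs
        rw [Function.update_self, Function.update_of_ne hus, hy u hu hus huv]
      · rw [Function.update_of_ne hus, Function.update_of_ne hvs, hf' u hu v hv hus hvs huv]
    have hf' : ∀ u ∈ G, ∀ v ∈ G, u ≠ s → v ≠ s → TriAdj u v → f u * φ u v = f v :=
      fun u hu v hv hus hvs => hf u (by simp [hu, hus]) v (by simp [hv, hvs])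
    by_cases hSW : (s.1 - 1, s.2 - 1) ∈ G
    · have hne : (s.1 - 1, s.2 - 1) ≠ s := fun h => by simpa using congrArg Prod.fst h
      have hadj : TriAdj (s.1 - 1, s.2 - 1) s := by simp [TriAdj]
      refine ⟨f, f (s.1 - 1, s.2 - 1) * φ (s.1 - 1, s.2 - 1) s, hf', fun u hu hus hadj' => ?_⟩
      have hadj'' : TriAdj (s.1 - 1, s.2 - 1) u := by
        rcases hnbr u hu hus hadj' with rfl | rfl | rfl <;> simp [TriAdj]
      rw [← hf' _ hSW u hu hne hus hadj'', mul_assoc, hφ _ hSW u hu s hs hadj'' hadj' hadj]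
    by_cases hW : (s.1 - 1, s.2) ∈ G
    · obtain ⟨χ, hχ, hχS⟩ := exists_separating_function hG hs hmax hSW hW
      set W := (s.1 - 1, s.2)
      set S := (s.1, s.2 - 1)
      refine ⟨fun u => if χ u = χ W then f u else f W * φ W s * (φ S s)⁻¹ * (f S)⁻¹ * f u,
        f W * φ W s, fun u hu v hv hus hvs huv => ?_, fun u hu hus hadj => ?_⟩
      · have h := hf' u hu v hv hus hvs huv
        simp only [hχ u hu v hv hus hvs huv]
        split_ifs <;> simp [h, mul_assoc]
      · rcases hnbr u hu hus hadj with rfl | rfl | rfl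
        · simp
        · simp [hχS hu, mul_assoc]
        · exact absurd hu hSW
    · refine ⟨f, f (s.1, s.2 - 1) * φ (s.1, s.2 - 1) s, hf', fun u hu hus hadj => ?_⟩
      rcases hnbr u hu hus hadj with rfl | rfl | rfl
      · exact absurd hu hW
      · rfl
      · exact absurd hu hSW

end TriAdj

section Nerve

open Path

variable {X : Type*} [TopologicalSpace X]

theorem symm_trans_cancel {x y z : X} (q : Homotopic.Quotient x y) (q' : Homotopic.Quotient y z) :
    q.symm.trans (q.trans q') = q' := by
  rw [← Homotopic.Quotient.trans_assoc, Homotopic.Quotient.symm_trans,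
    Homotopic.Quotient.refl_trans]

/-- A local version of an identity between homotopy classes of paths implies a global one. -/
theorem mk_trans_eq_of_locally {x₀ : X} (D : ∀ z : X, Homotopic.Quotient z x₀)
    {a b : X} (γ : Path a b)
    (h : ∀ t, ∃ V : Set X, IsOpen V ∧ γ t ∈ V ∧ ∀ (y z : X) (δ : Path y z), Set.range δ ⊆ V →
      (Homotopic.Quotient.mk δ).trans (D z) = D y) :
    (Homotopic.Quotient.mk γ).trans (D b) = D a := by
  have hloc : IsLocallyConstant fun t =>
      (Homotopic.Quotient.mk (γ.subpath 0 t)).trans (D (γ t)) := by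
    rw [IsLocallyConstant.iff_eventually_eq]
    intro t₀
    obtain ⟨V, hVo, hV, hD⟩ := h t₀
    have hmem : γ ⁻¹' V ∈ nhds t₀ := (hVo.preimage γ.continuous).mem_nhds hV
    have htend : Filter.Tendsto (fun t => Set.uIcc t₀ t) (nhds t₀) (nhds t₀).smallSets :=
      tendsto_const_nhds.uIcc Filter.tendsto_id
    filter_upwards [htend.eventually (Filter.eventually_smallSets_subset.2 hmem)] with t ht
    have hsub := hD _ _ (γ.subpath t₀ t) <| by
      rw [Path.range_subpath, Set.image_subset_iff]
      exact ht
    have htrans : Homotopic.Quotient.mk (γ.subpath 0 t) =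
        (Homotopic.Quotient.mk (γ.subpath 0 t₀)).trans (Homotopic.Quotient.mk (γ.subpath t₀ t)) :=
      (Homotopic.Quotient.eq.2 ⟨Path.Homotopy.subpathTransSubpath γ 0 t₀ t⟩).symm
    rw [htrans, Homotopic.Quotient.trans_assoc, hsub]
  have h01 := hloc.apply_eq_of_preconnectedSpace 1 0
  simp only [Path.subpath_zero_one, Path.subpath_self] at h01
  have key : ∀ (a' b' : X) (ha : a' = a) (hb : b' = b),
      (Homotopic.Quotient.mk (γ.cast ha hb)).trans (D b') = D a' →
        (Homotopic.Quotient.mk γ).trans (D b) = D a := by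
    rintro _ _ rfl rfl h
    exact h
  exact key _ _ γ.source γ.target (by simpa using h01)

/-- If finitely many open sets `C u` have the intersection pattern of the vertex stars of a subset
of the triangular lattice with connected complement, and all neighbours of each `C u` lie in a set
`B u` from a family of coherently simply connected sets, then every loop in the union of the
sets `C u` is null-homotopic. -/
theorem homotopic_refl_of_triAdj_cover [PathConnectedSpace X] (G : Finset (ℤ × ℤ))
    (hG : ∀ p ∉ G, ∀ q ∉ G,
      Relation.ReflTransGen (fun a b => TriAdj a b ∧ a ∉ G ∧ b ∉ G) p q)
    (C B : ℤ × ℤ → Set X) (hC : ∀ u ∈ G, IsOpen (C u)) (p : ℤ × ℤ → X) (hp : ∀ u ∈ G, p u ∈ C u)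
    (hadj : ∀ u ∈ G, ∀ v ∈ G, (C u ∩ C v).Nonempty → TriAdj u v)
    (hCB : ∀ u ∈ G, ∀ v ∈ G, TriAdj u v → C v ⊆ B u)
    (hB : ∀ u ∈ G, IsPathConnected (B u))
    (σ : ∀ y z : X, Homotopic.Quotient y z)
    (hσ : ∀ u ∈ G, ∀ (y z : X) (γ : Path y z), Set.range γ ⊆ B u → Homotopic.Quotient.mk γ = σ y z)
    {x₀ : X} (γ : Path x₀ x₀) (hγ : ∀ t, ∃ u ∈ G, γ t ∈ C u) :
    γ.Homotopic (Path.refl x₀) := by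
  have hσ_trans : ∀ u ∈ G, ∀ x ∈ B u, ∀ y ∈ B u, ∀ z ∈ B u,
      (σ x y).trans (σ y z) = σ x z := by
    intro u hu x hx y hy z hz
    obtain ⟨α, hα⟩ := (hB u hu).joinedIn x hx y hy
    obtain ⟨β, hβ⟩ := (hB u hu).joinedIn y hy z hz
    rw [← Set.range_subset_iff] at hα hβ
    rw [← hσ u hu x y α hα, ← hσ u hu y z β hβ, ← Homotopic.Quotient.mk_trans]
    exact hσ u hu x z _ (by rw [Path.trans_range]; exact Set.union_subset hα hβ)
  let c : ∀ u, Homotopic.Quotient x₀ (p u) := fun u =>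
    Homotopic.Quotient.mk (PathConnectedSpace.somePath x₀ (p u))
  have hpB : ∀ u ∈ G, ∀ v ∈ G, TriAdj u v → p v ∈ B u := fun u hu v hv huv =>
    hCB u hu v hv huv (hp v hv)
  obtain ⟨f, hf⟩ := TriAdj.exists_potential (H := FundamentalGroup X x₀) G hG
    (fun u v => (c v).trans ((σ (p v) (p u)).trans (c u).symm)) <| by
      intro u hu v hv w hw huv hvw huw
      have h := hσ_trans u hu _ (hpB u hu w hw huw) _ (hpB u hu v hv huv)
        _ (hpB u hu u hu (TriAdj.refl u))
      rw [FundamentalGroup.mul_def, ← h]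
      simp only [Homotopic.Quotient.trans_assoc]
      rw [symm_trans_cancel]
  let E : ∀ u, Homotopic.Quotient (p u) x₀ := fun u => (c u).symm.trans (f u)
  have hE : ∀ u ∈ G, ∀ v ∈ G, TriAdj u v → E v = (σ (p v) (p u)).trans (E u) := by
    intro u hu v hv huv
    have h := hf u hu v hv huv
    rw [FundamentalGroup.mul_def] at h
    simp only [E, ← h, Homotopic.Quotient.trans_assoc]
    rw [symm_trans_cancel]
  have hE' : ∀ u ∈ G, ∀ v ∈ G, ∀ z ∈ C u ∩ C v,
      (σ z (p v)).trans (E v) = (σ z (p u)).trans (E u) := by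
    intro u hu v hv z hz
    have huv := hadj u hu v hv ⟨z, hz⟩
    rw [hE u hu v hv huv, ← Homotopic.Quotient.trans_assoc,
      hσ_trans u hu z (hCB u hu v hv huv hz.2) _
      (hpB u hu v hv huv) _ (hpB u hu u hu (TriAdj.refl u))]
  obtain ⟨D, hD⟩ : ∃ D : ∀ z : X, Homotopic.Quotient z x₀,
      ∀ u ∈ G, ∀ z ∈ C u, D z = (σ z (p u)).trans (E u) := by
    classical
    refine ⟨fun z => if h : ∃ u ∈ G, z ∈ C u then (σ z (p h.choose)).trans (E h.choose)
      else Homotopic.Quotient.mk (PathConnectedSpace.somePath z x₀), fun u hu z hz => ?_⟩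
    have h : ∃ u ∈ G, z ∈ C u := ⟨u, hu, hz⟩
    simp only [dif_pos h]
    exact hE' u hu _ h.choose_spec.1 z ⟨hz, h.choose_spec.2⟩
  have hγD := mk_trans_eq_of_locally D γ fun t => by
    obtain ⟨u, hu, hut⟩ := hγ t
    refine ⟨C u, hC u hu, hut, fun y z δ hδ => ?_⟩
    have hCu := hCB u hu u hu (TriAdj.refl u)
    have hy : y ∈ C u := by simpa using hδ (Set.mem_range_self 0)
    have hz : z ∈ C u := by simpa using hδ (Set.mem_range_self 1)
    rw [hD u hu y hy, hD u hu z hz, hσ u hu y z δ (hδ.trans hCu), ← Homotopic.Quotient.trans_assoc,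
      hσ_trans u hu y (hCu hy) z (hCu hz) _ (hpB u hu u hu (TriAdj.refl u))]
  rw [← Homotopic.Quotient.eq, Homotopic.Quotient.mk_refl]
  have h := congrArg (fun q => q.trans (D x₀).symm) hγD
  simpa using h

end Nerve

theorem Path.Homotopic.of_range_subset_isSimplyConnected {X : Type*} [TopologicalSpace X]
    {s : Set X} (hs : IsSimplyConnected s) {x y : X} (γ δ : Path x y)
    (hγ : Set.range γ ⊆ s) (hδ : Set.range δ ⊆ s) : γ.Homotopic δ := by
  have := hs.simplyConnectedSpace
  rw [Set.range_subset_iff] at hγ hδ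
  have hx : x ∈ s := by simpa using hγ 0
  have hy : y ∈ s := by simpa using hγ 1
  let γ' : Path (⟨x, hx⟩ : s) ⟨y, hy⟩ := ⟨⟨fun t => ⟨γ t, hγ t⟩, by fun_prop⟩, by simp, by simp⟩
  let δ' : Path (⟨x, hx⟩ : s) ⟨y, hy⟩ := ⟨⟨fun t => ⟨δ t, hδ t⟩, by fun_prop⟩, by simp, by simp⟩
  exact (SimplyConnectedSpace.paths_homotopic γ' δ').map ⟨Subtype.val, continuous_subtype_val⟩

theorem isSimplyConnected_preimage_val {X : Type*} [TopologicalSpace X] {s t : Set X} (hst : t ⊆ s)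
    (ht : IsSimplyConnected t) : IsSimplyConnected ((↑) ⁻¹' t : Set s) := by
  rw [← Topology.IsEmbedding.subtypeVal.isSimplyConnected_image,
    Subtype.image_preimage_coe, Set.inter_eq_right.2 hst]
  exact ht

theorem isSimplyConnected_ball {E : Type*} [NormedAddCommGroup E] [NormedSpace ℝ E] (x : E)
    {r : ℝ} (hr : 0 < r) : IsSimplyConnected (Metric.ball x r) := by
  have := Metric.contractibleSpace_ball (x := x) hr
  exact SimplyConnectedSpace.ofContractible _

/-- Homotopy classes of paths in an open set can be chosen so as to represent all paths which
lie in some ball contained in that set. -/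
theorem exists_homotopy_class_of_mem_ball {U : Set ℂ} [PathConnectedSpace U] :
    ∃ σ : ∀ y z : U, Path.Homotopic.Quotient y z, ∀ (c : ℂ) (ρ : ℝ), Metric.ball c ρ ⊆ U →
      ∀ (y z : U) (γ : Path y z), Set.range γ ⊆ (↑) ⁻¹' Metric.ball c ρ →
        Path.Homotopic.Quotient.mk γ = σ y z := by
  classical
  refine ⟨fun y z => if h : ∃ γ : Path y z, Set.range γ ⊆ (↑) ⁻¹' segment ℝ (y : ℂ) z then
      .mk h.choose else .mk (PathConnectedSpace.somePath y z), fun c ρ hU y z γ hγ => ?_⟩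
  have hy : (y : ℂ) ∈ Metric.ball c ρ := by simpa using hγ (Set.mem_range_self 0)
  have hz : (z : ℂ) ∈ Metric.ball c ρ := by simpa using hγ (Set.mem_range_self 1)
  have hseg : segment ℝ (y : ℂ) z ⊆ Metric.ball c ρ :=
    (convex_ball c ρ).segment_subset hy hz
  have h : ∃ γ : Path y z, Set.range γ ⊆ (↑) ⁻¹' segment ℝ (y : ℂ) z := by
    have hmem : ∀ t : unitInterval, AffineMap.lineMap (y : ℂ) (z : ℂ) (t : ℝ) ∈
        segment ℝ (y : ℂ) z := fun t => by
      rw [segment_eq_image_lineMap]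
      exact Set.mem_image_of_mem _ t.2
    refine ⟨⟨⟨fun t => ⟨_, hU (hseg (hmem t))⟩, ?_⟩, by simp, by simp⟩,
      Set.range_subset_iff.2 hmem⟩
    exact (AffineMap.lineMap_continuous.comp continuous_subtype_val).subtype_mk _
  simp only [dif_pos h, Path.Homotopic.Quotient.eq]
  exact .of_range_subset_isSimplyConnected (isSimplyConnected_preimage_val hU
    (isSimplyConnected_ball c (Metric.pos_of_mem_ball hy))) _ _ hγ
    (h.choose_spec.trans (Set.preimage_mono hseg))

section Cells

/-- The open star of the vertex `u` in the triangulation of the plane with mesh `h`. -/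
def vertexStar (h : ℝ) (u : ℤ × ℤ) : Set ℂ :=
  {z | |z.re / h - u.1| < 1 ∧ |z.im / h - u.2| < 1 ∧ |(z.re / h - u.1) - (z.im / h - u.2)| < 1}

/-- The vertex `u` of the triangulation of the plane with mesh `h`. -/
def latticePoint (h : ℝ) (u : ℤ × ℤ) : ℂ := ⟨h * u.1, h * u.2⟩

theorem isOpen_vertexStar (h : ℝ) (u : ℤ × ℤ) : IsOpen (vertexStar h u) := by
  unfold vertexStar
  refine (isOpen_lt ?_ ?_).and ((isOpen_lt ?_ ?_).and (isOpen_lt ?_ ?_)) <;> fun_prop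

theorem latticePoint_mem_vertexStar {h : ℝ} (hh : 0 < h) (u : ℤ × ℤ) :
    latticePoint h u ∈ vertexStar h u := by
  simp [latticePoint, vertexStar, hh.ne']

theorem exists_mem_vertexStar (h : ℝ) (z : ℂ) : ∃ u, z ∈ vertexStar h u := by
  refine ⟨(⌊z.re / h⌋, ⌊z.im / h⌋), ?_⟩
  have h₁ := Int.floor_le (z.re / h)
  have h₂ := Int.lt_floor_add_one (z.re / h)
  have h₃ := Int.floor_le (z.im / h)
  have h₄ := Int.lt_floor_add_one (z.im / h)
  simp only [vertexStar, Set.mem_ofPred_eq, abs_lt]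
  refine ⟨⟨?_, ?_⟩, ⟨?_, ?_⟩, ?_, ?_⟩ <;> linarith

theorem triAdj_of_mem_vertexStar {h : ℝ} {z : ℂ} {u v : ℤ × ℤ} (hu : z ∈ vertexStar h u)
    (hv : z ∈ vertexStar h v) : TriAdj u v := by
  have key : ∀ {a b : ℝ} {n : ℤ}, |a| < 1 → |b| < 1 → (n : ℝ) = b - a → |n| ≤ 1 := by
    intro a b n ha hb hn
    have h2 : |(n : ℝ)| < 2 := by
      rw [hn]
      exact (abs_sub _ _).trans_lt (by linarith)
    have : |n| < 2 := by exact_mod_cast h2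
    omega
  refine ⟨key hu.1 hv.1 ?_, key hu.2.1 hv.2.1 ?_, key hu.2.2 hv.2.2 ?_⟩ <;> push_cast <;> ring

theorem dist_latticePoint_lt {h : ℝ} (hh : 0 < h) {z : ℂ} {u : ℤ × ℤ} (hz : z ∈ vertexStar h u) :
    dist z (latticePoint h u) < 2 * h := by
  have key : ∀ {a : ℝ} {n : ℤ}, |a / h - n| < 1 → |a - h * n| < h := by
    intro a n ha
    have : a - h * n = h * (a / h - n) := by field_simp
    rw [this, abs_mul, abs_of_pos hh]
    nlinarith
  rw [Complex.dist_eq]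
  refine (Complex.norm_le_abs_re_add_abs_im _).trans_lt ?_
  have h₁ := key hz.1
  have h₂ := key hz.2.1
  simp only [latticePoint, Complex.sub_re, Complex.sub_im]
  linarith

theorem dist_latticePoint_le_of_triAdj {h : ℝ} (hh : 0 < h) {u v : ℤ × ℤ} (huv : TriAdj u v) :
    dist (latticePoint h u) (latticePoint h v) ≤ 2 * h := by
  have key : ∀ {m n : ℤ}, |m - n| ≤ 1 → |h * m - h * n| ≤ h := by
    intro m n hmn
    have : |(m : ℝ) - n| ≤ 1 := by exact_mod_cast hmn
    rw [← mul_sub, abs_mul, abs_of_pos hh]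
    nlinarith
  rw [Complex.dist_eq]
  refine (Complex.norm_le_abs_re_add_abs_im _).trans ?_
  have h₁ := key huv.1
  have h₂ := key huv.2.1
  simp only [latticePoint, Complex.sub_re, Complex.sub_im]
  linarith

/-- The vertex stars which meet a preconnected set form a connected subgraph. -/
theorem reflTransGen_triAdj_of_isPreconnected (h : ℝ) {M : Set ℂ} (hM : IsPreconnected M)
    {p q : ℤ × ℤ} (hp : (vertexStar h p ∩ M).Nonempty) (hq : (vertexStar h q ∩ M).Nonempty) :
    Relation.ReflTransGen (fun a b => TriAdj a b ∧ (vertexStar h a ∩ M).Nonempty ∧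
      (vertexStar h b ∩ M).Nonempty) p q := by
  set R := Relation.ReflTransGen (fun a b => TriAdj a b ∧ (vertexStar h a ∩ M).Nonempty ∧
      (vertexStar h b ∩ M).Nonempty) p
  by_contra hpq
  obtain ⟨x, hxp, hxM⟩ := hp
  obtain ⟨y, hyq, hyM⟩ := hq
  obtain ⟨z, hzM, hzu, hzv⟩ := hM (⋃ u ∈ {u | R u}, vertexStar h u)
    (⋃ u ∈ {u | ¬ R u}, vertexStar h u)
    (isOpen_biUnion fun u _ => isOpen_vertexStar h u)
    (isOpen_biUnion fun u _ => isOpen_vertexStar h u)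
    (fun z _ => by
      obtain ⟨u, hu⟩ := exists_mem_vertexStar h z
      by_cases hR : R u
      · exact .inl (Set.mem_biUnion hR hu)
      · exact .inr (Set.mem_biUnion hR hu))
    ⟨x, hxM, Set.mem_biUnion (Relation.ReflTransGen.refl : R p) hxp⟩
    ⟨y, hyM, Set.mem_biUnion hpq hyq⟩
  simp only [Set.mem_iUnion, exists_prop, Set.mem_ofPred_eq] at hzu hzv
  obtain ⟨u, hu, hzu⟩ := hzu
  obtain ⟨v, hv, hzv⟩ := hzv
  exact hv (Relation.ReflTransGen.tail hu
    ⟨triAdj_of_mem_vertexStar hzu hzv, ⟨z, hzu, hzM⟩, ⟨z, hzv, hzM⟩⟩)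

theorem finite_setOf_latticePoint_mem {h : ℝ} (hh : 0 < h) {U : Set ℂ}
    (hU : Bornology.IsBounded U) : {u | latticePoint h u ∈ U}.Finite := by
  obtain ⟨R, hR⟩ := hU.exists_norm_le
  have key : ∀ {n : ℤ}, |h * n| ≤ R → n ∈ Set.Icc (-⌈R / h⌉) ⌈R / h⌉ := by
    intro n hn
    have h₁ : |(n : ℝ)| ≤ R / h := by
      rw [le_div_iff₀ hh]
      rwa [abs_mul, abs_of_pos hh, mul_comm] at hn
    have h₂ : |(n : ℝ)| ≤ ⌈R / h⌉ := h₁.trans (Int.le_ceil _)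
    exact abs_le.1 (by exact_mod_cast h₂)
  refine ((Set.finite_Icc _ _).prod (Set.finite_Icc _ _)).subset fun u hu => ⟨key ?_, key ?_⟩
  · exact (Complex.abs_re_le_norm (latticePoint h u)).trans (hR _ hu)
  · exact (Complex.abs_im_le_norm (latticePoint h u)).trans (hR _ hu)

end Cells

theorem IsPreconnected.thickening {E : Type*} [SeminormedAddCommGroup E] [NormedSpace ℝ E]
    {s : Set E} (hs : IsPreconnected s) {δ : ℝ} (hδ : 0 < δ) :
    IsPreconnected (Metric.thickening δ s) := by
  have hball : ∀ x ∈ Metric.thickening δ s, ∃ y ∈ s, x ∈ Metric.ball y δ :=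
    fun x hx => Metric.mem_thickening_iff.1 hx
  have hsub := Metric.self_subset_thickening hδ s
  have hunion : ∀ y ∈ s, IsPreconnected (s ∪ Metric.ball y δ) := fun y hy =>
    hs.union y hy (Metric.mem_ball_self hδ) (convex_ball y δ).isPreconnected
  refine isPreconnected_of_forall_pair fun x hx y hy => ?_
  obtain ⟨a, ha, hxa⟩ := hball x hx
  obtain ⟨b, hb, hyb⟩ := hball y hy
  refine ⟨(s ∪ Metric.ball a δ) ∪ (s ∪ Metric.ball b δ), ?_, .inl (.inr hxa), .inr (.inr hyb),
    (hunion a ha).union a (.inl ha) (.inl ha) (hunion b hb)⟩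
  exact Set.union_subset (Set.union_subset hsub (Metric.ball_subset_thickening ha δ))
    (Set.union_subset hsub (Metric.ball_subset_thickening hb δ))

/-- A bounded domain with connected complement is simply connected. -/
theorem isSimplyConnected_of_isPreconnected_compl {U : Set ℂ} (hUo : IsOpen U)
    (hUc : IsConnected U) (hUb : Bornology.IsBounded U) (hU : IsPreconnected Uᶜ) :
    IsSimplyConnected U := by
  have hpath := hUo.isConnected_iff_isPathConnected.1 hUc
  have := isPathConnected_iff_pathConnectedSpace.1 hpath
  rw [IsSimplyConnected, simply_connected_iff_loops_nullhomotopic]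
  refine ⟨inferInstance, fun x₀ γ => ?_⟩
  obtain ⟨δ, hδ, hδU⟩ := (isCompact_range (continuous_subtype_val.comp γ.continuous)
    ).exists_thickening_subset_open hUo (by rintro _ ⟨t, rfl⟩; exact (γ t).2)
  obtain ⟨h, hh, rfl⟩ : ∃ h : ℝ, 0 < h ∧ δ = 8 * h := ⟨δ / 8, by positivity, by ring⟩
  set M := Metric.thickening (4 * h) Uᶜ
  have hball : ∀ z ∉ M, Metric.ball z (4 * h) ⊆ U := by
    intro z hz w hw
    by_contra hwU
    exact hz (Metric.mem_thickening_iff.2 ⟨w, hwU, by rwa [dist_comm]⟩)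
  have hgood : ∀ {u}, ¬ (vertexStar h u ∩ M).Nonempty → ∀ z ∈ vertexStar h u, z ∉ M :=
    fun hu z hz hzM => hu ⟨z, hz, hzM⟩
  have hfin : {u | ¬ (vertexStar h u ∩ M).Nonempty}.Finite :=
    (finite_setOf_latticePoint_mem hh hUb).subset fun u hu =>
      hball _ (hgood hu _ (latticePoint_mem_vertexStar hh u)) (Metric.mem_ball_self (by positivity))
  set G := hfin.toFinset
  have hGmem : ∀ {u}, u ∈ G ↔ ¬ (vertexStar h u ∩ M).Nonempty := by simp [G]
  have hGball : ∀ u ∈ G, Metric.ball (latticePoint h u) (4 * h) ⊆ U := fun u hu =>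
    hball _ (hgood (hGmem.1 hu) _ (latticePoint_mem_vertexStar hh u))
  have hGU : ∀ u ∈ G, latticePoint h u ∈ U := fun u hu =>
    hGball u hu (Metric.mem_ball_self (by positivity))
  classical
  let p : ℤ × ℤ → U := fun u => if hu : u ∈ G then ⟨latticePoint h u, hGU u hu⟩ else x₀
  have hpval : ∀ u ∈ G, (p u : ℂ) = latticePoint h u := fun u hu => by simp [p, hu]
  obtain ⟨σ, hσ⟩ := exists_homotopy_class_of_mem_ball (U := U)
  refine homotopic_refl_of_triAdj_cover G ?_ (fun u => (↑) ⁻¹' vertexStar h u)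
    (fun u => (↑) ⁻¹' Metric.ball (latticePoint h u) (4 * h))
    (fun u _ => (isOpen_vertexStar h u).preimage continuous_subtype_val) p ?_ ?_ ?_ ?_ σ ?_ γ ?_
  · intro a ha b hb
    simp only [hGmem, not_not] at ha hb ⊢
    exact reflTransGen_triAdj_of_isPreconnected h (hU.thickening (by positivity)) ha hb
  · intro u hu
    simpa [hpval u hu] using latticePoint_mem_vertexStar hh u
  · rintro u - v - ⟨z, hzu, hzv⟩
    exact triAdj_of_mem_vertexStar hzu hzv
  · intro u _ v _ huv z hz
    have h₁ := dist_latticePoint_lt hh hz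
    have h₂ := dist_latticePoint_le_of_triAdj hh huv.symm
    have h₃ := dist_triangle (z : ℂ) (latticePoint h v) (latticePoint h u)
    simp only [Set.mem_preimage, Metric.mem_ball]
    linarith
  · intro u hu
    exact (isSimplyConnected_preimage_val (hGball u hu)
      (isSimplyConnected_ball _ (by positivity))).isPathConnected
  · intro u hu
    exact hσ _ _ (hGball u hu)
  · intro t
    obtain ⟨u, hu⟩ := exists_mem_vertexStar h (γ t : ℂ)
    refine ⟨u, hGmem.2 ?_, hu⟩
    rintro ⟨z, hz, hzM⟩
    obtain ⟨w, hwU, hzw⟩ := Metric.mem_thickening_iff.1 hzM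
    refine hwU (hδU (Metric.mem_thickening_iff.2 ⟨γ t, ⟨t, rfl⟩, ?_⟩))
    have h₁ := dist_latticePoint_lt hh hz
    have h₂ := dist_latticePoint_lt hh hu
    have h₃ := dist_triangle4 w z (latticePoint h u) (γ t : ℂ)
    rw [dist_comm w z, dist_comm (latticePoint h u)] at h₃
    linarith

/-- If the complement of an open set is connected, then so is the complement of each of its
connected components. -/
theorem isPreconnected_compl_connectedComponentIn {X : Type*} [TopologicalSpace X]
    [PreconnectedSpace X] [LocallyConnectedSpace X] {W : Set X} (hW : IsOpen W)
    (hWc : IsConnected Wᶜ) (z : X) : IsPreconnected (connectedComponentIn W z)ᶜ := by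
  obtain ⟨m, hm⟩ := hWc.nonempty
  have hsub : Wᶜ ⊆ (connectedComponentIn W z)ᶜ :=
    Set.compl_subset_compl.2 (connectedComponentIn_subset W z)
  refine isPreconnected_of_forall m fun y hy => ?_
  by_cases hyW : y ∈ W
  · set V := connectedComponentIn W y
    have hyV : y ∈ V := mem_connectedComponentIn hyW
    have hVc : IsPreconnected (closure V) := isPreconnected_connectedComponentIn.closure
    have hmeet : (Wᶜ ∩ closure V).Nonempty := by
      by_contra! hempty
      have hclosure : closure V ⊆ W := by
        rwa [← Set.disjoint_iff_inter_eq_empty, Set.disjoint_compl_left_iff_subset] at hempty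
      have hclosed : IsClosed V := isClosed_of_closure_subset
        (hVc.subset_connectedComponentIn (subset_closure hyV) hclosure)
      have huniv := IsClopen.eq_univ ⟨hclosed, hW.connectedComponentIn⟩ ⟨y, hyV⟩
      exact hm (connectedComponentIn_subset W y (show m ∈ V by rw [huniv]; trivial))
    have hdisj : Disjoint V (connectedComponentIn W z) := by
      rw [Set.disjoint_left]
      intro w hwV hwz
      exact hy ((connectedComponentIn_eq hwz).trans (connectedComponentIn_eq hwV).symm ▸ hyV)
    exact ⟨Wᶜ ∪ closure V, Set.union_subset hsub
      (hdisj.closure_left hW.connectedComponentIn).subset_compl_right, .inl hm,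
      .inr (subset_closure hyV), hWc.isPreconnected.union' hmeet hVc⟩
  · exact ⟨Wᶜ, hsub, hm, hyW, hWc.isPreconnected⟩

theorem isConnected_compl_ball_diff {x : ℂ} {r : ℝ} (hr : 0 < r) {K : Set ℂ}
    (hconn : IsConnected (K ∪ Metric.sphere x r)) : IsConnected (Metric.ball x r \ K)ᶜ := by
  have hsub : K ∪ Metric.sphere x r ⊆ (Metric.ball x r \ K)ᶜ := by
    rintro z (hz | hz) ⟨hzb, hzK⟩
    · exact hzK hz
    · exact (Metric.mem_ball.1 hzb).ne hz
  obtain ⟨m, hm⟩ := hconn.nonempty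
  refine ⟨⟨m, hsub hm⟩, isPreconnected_of_forall m fun y hy => ?_⟩
  by_cases hyK : y ∈ K
  · exact ⟨_, hsub, hm, .inl hyK, hconn.isPreconnected⟩
  have hry : r ≤ ‖y - x‖ := by
    by_contra! hlt
    exact hy ⟨by rwa [Metric.mem_ball, dist_eq_norm], hyK⟩
  have hpos : 0 < ‖y - x‖ := hr.trans_le hry
  let ray : ℝ → ℂ := fun t => x + (t / ‖y - x‖ : ℝ) • (y - x)
  have hray : ∀ t, 0 < t → ‖ray t - x‖ = t := by
    intro t ht
    simp only [ray, add_sub_cancel_left, norm_smul, Real.norm_eq_abs]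
    rw [abs_of_pos (by positivity), div_mul_cancel₀ _ hpos.ne']
  have hray_conn : IsPreconnected (ray '' Set.Ici r) :=
    isPreconnected_Ici.image _ (by fun_prop)
  refine ⟨(K ∪ Metric.sphere x r) ∪ ray '' Set.Ici r, Set.union_subset hsub ?_, .inl hm,
    .inr ⟨‖y - x‖, hry, by
      simp only [ray]; rw [div_self hpos.ne', one_smul, add_sub_cancel]⟩,
    hconn.isPreconnected.union (ray r) (.inr ?_) ⟨r, Set.self_mem_Ici, rfl⟩ hray_conn⟩
  · rintro _ ⟨t, ht, rfl⟩ ⟨hb, -⟩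
    rw [Metric.mem_ball, dist_eq_norm, hray t (hr.trans_le ht)] at hb
    exact hb.not_ge ht
  · rw [mem_sphere_iff_norm, hray r hr]

theorem components_of_disk_minus_closed_set_simplyConnected
    (x : ℂ) (r : ℝ) (hr : 0 < r) (K : Set ℂ) (hK : IsClosed K)
    (hconn : IsConnected (K ∪ Metric.sphere x r)) :
    ∀ z ∈ Metric.ball x r \ K,
      IsOpen (connectedComponentIn (Metric.ball x r \ K) z) ∧
      SimplyConnectedSpace ↥(connectedComponentIn (Metric.ball x r \ K) z) := by
  intro z hz
  have hW : IsOpen (Metric.ball x r \ K) := Metric.isOpen_ball.sdiff hK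
  refine ⟨hW.connectedComponentIn, isSimplyConnected_of_isPreconnected_compl
    hW.connectedComponentIn (isConnected_connectedComponentIn_iff.2 hz) ?_
    (isPreconnected_compl_connectedComponentIn hW (isConnected_compl_ball_diff hr hconn) z)⟩
  exact Metric.isBounded_ball.subset ((connectedComponentIn_subset _ _).trans Set.sdiff_subset)
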